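/- arXiv:1708.00934 — 2 statements merged into one kernel-verified Lean document; each statement's English description precedes it below -/
import Mathlib

section
/- Let S be an S-tree. Then there exists a matching M in S of cardinality |Core(S)| such that every edge of M has one endpoint in Core(S) and the other endpoint in Supp(S). -/
open scoped Classical

namespace NullDecomp

variable {V : Type*}

/-- The null space of the real adjacency matrix of a graph. -/
def nullSpace [Fintype V] (G : SimpleGraph V) : Set (V → ℝ) :=
  {x | Matrix.mulVec (G.adjMatrix ℝ) x = 0}

/-- The support of the null space: vertices with a nonzero entry in some null vector. -/
def supportSet [Fintype V] (G : SimpleGraph V) : Set V :=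
  {v | ∃ x ∈ nullSpace G, x v ≠ 0}

/-- The (open) neighborhood of a set of vertices. -/
def nbhdSet (G : SimpleGraph V) (A : Set V) : Set V :=
  {v | ∃ u ∈ A, G.Adj u v}

/-- The closed neighborhood of a set of vertices. -/
def closedNbhd (G : SimpleGraph V) (A : Set V) : Set V :=
  A ∪ nbhdSet G A

/-- The core of a graph: the neighborhood of the support of the null space. -/
def coreSet [Fintype V] (G : SimpleGraph V) : Set V :=
  nbhdSet G (supportSet G)

/-- A tree is an S-tree if the closed neighborhood of its support is everything. -/
def IsSTree [Fintype V] (G : SimpleGraph V) : Prop :=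
  G.IsTree ∧ closedNbhd G (supportSet G) = Set.univ

/-- A matching: a set of edges of `G`, pairwise disjoint. -/
def IsMatchingSet (G : SimpleGraph V) (M : Finset (Sym2 V)) : Prop :=
  (↑M : Set (Sym2 V)) ⊆ G.edgeSet ∧
    ∀ e ∈ M, ∀ f ∈ M, e ≠ f → ∀ v : V, v ∈ e → v ∉ f

/-- A maximum matching. -/
def IsMaxMatching [Fintype V] (G : SimpleGraph V) (M : Finset (Sym2 V)) : Prop :=
  IsMatchingSet G M ∧ ∀ M' : Finset (Sym2 V), IsMatchingSet G M' → M'.card ≤ M.card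

/-- The matching number. -/
noncomputable def matchingNumber [Fintype V] (G : SimpleGraph V) : ℕ :=
  sSup {n | ∃ M : Finset (Sym2 V), IsMatchingSet G M ∧ M.card = n}

/-- An independent set of vertices. -/
def IsIndep (G : SimpleGraph V) (A : Set V) : Prop :=
  ∀ u ∈ A, ∀ w ∈ A, ¬ G.Adj u w

/-- The independence number. -/
noncomputable def indepNumber [Fintype V] (G : SimpleGraph V) : ℕ :=
  sSup {n | ∃ A : Set V, IsIndep G A ∧ A.ncard = n}

/-- A vertex cover. -/
def IsVertexCover (G : SimpleGraph V) (Cs : Set V) : Prop :=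
  ∀ e ∈ G.edgeSet, ∃ v ∈ Cs, v ∈ e

/-- The vertex cover number. -/
noncomputable def coverNumber [Fintype V] (G : SimpleGraph V) : ℕ :=
  sInf {n | ∃ Cs : Set V, IsVertexCover G Cs ∧ Cs.ncard = n}

/-- The nullity of a graph: dimension of the kernel of its adjacency matrix. -/
noncomputable def nullity [Fintype V] (G : SimpleGraph V) : ℕ :=
  Module.finrank ℝ (LinearMap.ker (Matrix.mulVecLin (G.adjMatrix ℝ)))

/-- The number of maximum matchings of a graph. -/
noncomputable def numMaxMatchings [Fintype V] (G : SimpleGraph V) : ℕ :=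
  Set.ncard {M : Finset (Sym2 V) | IsMaxMatching G M}

/-- `C` is (the vertex set of) a connected component of the subgraph of `T`
induced by the closed neighborhood of the support of `T`. -/
def IsSComponent [Fintype V] (T : SimpleGraph V) (C : Set V) : Prop :=
  ∃ c : (T.induce (closedNbhd T (supportSet T))).ConnectedComponent,
    C = Subtype.val '' c.supp

/-- `C` is (the vertex set of) a connected component of the subgraph of `T`
induced by the complement of the closed neighborhood of the support of `T`. -/
def IsNComponent [Fintype V] (T : SimpleGraph V) (C : Set V) : Prop :=
  ∃ c : (T.induce ((closedNbhd T (supportSet T))ᶜ)).ConnectedComponent,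
    C = Subtype.val '' c.supp

/-- The zero-extension to `ℝ^V` of the null space of the subgraph of `T` induced by `C`:
vectors vanishing outside `C` whose restriction to `C` is a null vector of `T.induce C`. -/
noncomputable def extNull [Fintype V] (T : SimpleGraph V) (C : Set V) : Submodule ℝ (V → ℝ) :=
  LinearMap.ker ((Matrix.mulVecLin ((T.induce C).adjMatrix ℝ)).comp
      (LinearMap.funLeft ℝ ℝ (Subtype.val : ↥C → V))) ⊓
  LinearMap.ker (LinearMap.funLeft ℝ ℝ (Subtype.val : ↥(Cᶜ) → V))

theorem mem_nullSpace_iff [Fintype V] {G : SimpleGraph V} {x : V → ℝ} :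
    x ∈ nullSpace G ↔ ∀ v, ∑ j, (if G.Adj v j then x j else 0) = 0 := by
  simp [nullSpace, funext_iff, Finset.sum_ite, SimpleGraph.neighborFinset_eq_filter]

/-- Across an edge of a forest, any two null vectors have proportional values: their Wronskian is a
divergence-free flow, and the edge is a cut. -/
theorem mul_eq_mul_of_adj [Fintype V] {G : SimpleGraph V} (hG : G.IsAcyclic) {x y : V → ℝ}
    (hx : x ∈ nullSpace G) (hy : y ∈ nullSpace G) {u w : V} (huw : G.Adj u w) :
    x u * y w = y u * x w := by
  rw [mem_nullSpace_iff] at hx hy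
  have hbr : ¬(G.deleteEdges {s(u, w)}).Reachable u w :=
    SimpleGraph.isBridge_iff.1 (SimpleGraph.isAcyclic_iff_forall_adj_isBridge.1 hG huw)
  let C : Finset V := Finset.univ.filter fun v => (G.deleteEdges {s(u, w)}).Reachable u v
  have hC : ∀ v, v ∈ C ↔ (G.deleteEdges {s(u, w)}).Reachable u v := by simp [C]
  let c : V → V → ℝ := fun i j => if G.Adj i j then x i * y j - y i * x j else 0
  have hdiv : ∀ i, ∑ j, c i j = 0 := fun i => by
    have h : ∀ j, c i j = x i * (if G.Adj i j then y j else 0)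
        - y i * (if G.Adj i j then x j else 0) := fun j => by
      dsimp only [c]; split_ifs <;> ring
    simp only [h, Finset.sum_sub_distrib, ← Finset.mul_sum, hx, hy, mul_zero, sub_zero]
  have hanti : ∀ i j, c i j = -c j i := fun i j => by
    simp only [c, G.adj_comm i j]
    split_ifs <;> ring
  have hin : ∑ i ∈ C, ∑ j ∈ C, c i j = 0 := by
    have h : ∑ i ∈ C, ∑ j ∈ C, c i j = -∑ i ∈ C, ∑ j ∈ C, c i j := by
      conv_lhs => rw [Finset.sum_comm]
      simp only [← Finset.sum_neg_distrib]
      exact Finset.sum_congr rfl fun i _ => Finset.sum_congr rfl fun j _ => hanti j i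
    linarith
  have hcut : ∀ i ∈ C, ∀ j ∉ C, G.Adj i j → i = u ∧ j = w := fun i hi j hj hij => by
    by_cases he : s(i, j) = s(u, w)
    · rcases Sym2.eq_iff.1 he with h | ⟨rfl, rfl⟩
      · exact h
      · exact absurd ((hC _).1 hi) hbr
    · refine absurd ((hC j).2 (((hC i).1 hi).trans (SimpleGraph.Adj.reachable ?_))) hj
      simpa [SimpleGraph.deleteEdges_adj, hij] using he
  have hout : ∑ i ∈ C, ∑ j ∈ Cᶜ, c i j = c u w := by
    rw [Finset.sum_eq_single u, Finset.sum_eq_single w]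
    · exact fun j hj hjw => if_neg fun h =>
        hjw (hcut u ((hC u).2 .rfl) j (Finset.mem_compl.1 hj) h).2
    · exact fun h => absurd (Finset.mem_compl.2 fun hw => hbr ((hC w).1 hw)) h
    · exact fun i hi hiu => Finset.sum_eq_zero fun j hj => if_neg fun h =>
        hiu (hcut i hi j (Finset.mem_compl.1 hj) h).1
    · exact fun h => absurd ((hC u).2 .rfl) h
  have htot : ∑ i ∈ C, (∑ j ∈ C, c i j + ∑ j ∈ Cᶜ, c i j) = 0 :=
    Finset.sum_eq_zero fun i _ => by rw [Finset.sum_add_sum_compl, hdiv]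
  rw [Finset.sum_add_distrib, hin, hout, zero_add] at htot
  simp only [c, huw, if_true] at htot
  linarith

/-- Restricting a null vector to a colour class of a two-colouring gives a null vector. -/
theorem ite_color_mem_nullSpace [Fintype V] {G : SimpleGraph V} (f : G.Coloring (Fin 2))
    {x : V → ℝ} (hx : x ∈ nullSpace G) (a : Fin 2) :
    (fun v => if f v = a then x v else 0) ∈ nullSpace G := by
  rw [mem_nullSpace_iff] at hx ⊢
  intro v
  by_cases hv : f v = a
  · refine Finset.sum_eq_zero fun j _ => ?_
    split_ifs with h h'
    · exact absurd (hv.trans h'.symm) (f.valid h)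
    · rfl
    · rfl
  · refine (Finset.sum_congr rfl fun j _ => ?_).trans (hx v)
    by_cases h : G.Adj v j
    · have := f.valid h
      have hj : f j = a := by omega
      simp [h, hj]
    · simp [h]

theorem isIndep_supportSet [Fintype V] {G : SimpleGraph V} (hG : G.IsAcyclic) :
    IsIndep G (supportSet G) := by
  rintro u ⟨x, hx, hxu⟩ w ⟨y, hy, hyw⟩ huw
  have hne := hG.coloringTwo.valid huw
  have h := mul_eq_mul_of_adj hG (ite_color_mem_nullSpace hG.coloringTwo hx (hG.coloringTwo u))
    (ite_color_mem_nullSpace hG.coloringTwo hy (hG.coloringTwo w)) huw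
  simp [hne, hxu, hyw] at h

/-- A core vertex has at least two supported neighbors. -/
theorem exists_ne_adj_mem_supportSet [Fintype V] {G : SimpleGraph V} {v : V}
    (hv : v ∈ coreSet G) :
    ∃ a ∈ supportSet G, ∃ b ∈ supportSet G, a ≠ b ∧ G.Adj v a ∧ G.Adj v b := by
  obtain ⟨a, ⟨x, hx, hxa⟩, hav⟩ := hv
  have hsum := mem_nullSpace_iff.1 hx v
  by_contra! hcon
  refine hxa ?_
  rw [Finset.sum_eq_single a, if_pos hav.symm] at hsum
  · exact hsum
  · intro b _ hba
    split_ifs with hb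
    · by_contra hxb
      exact hcon a ⟨x, hx, hxa⟩ b ⟨x, hx, hxb⟩ hba.symm hav.symm hb
    · rfl
  · simp

/-- In a tree, a vertex has at most one neighbor closer to a given root. -/
theorem eq_of_adj_of_dist_eq_add_one {G : SimpleGraph V} (hG : G.IsTree) {r a b v : V}
    (ha : G.Adj a v) (hb : G.Adj b v) (hda : G.dist r v = G.dist r a + 1)
    (hdb : G.dist r v = G.dist r b + 1) : a = b := by
  obtain ⟨p, hp⟩ := hG.connected.exists_walk_length_eq_dist r a
  obtain ⟨q, hq⟩ := hG.connected.exists_walk_length_eq_dist r b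
  have hp' := (p.concat ha).isPath_of_length_eq_dist (by rw [p.length_concat, hp, hda])
  have hq' := (q.concat hb).isPath_of_length_eq_dist (by rw [q.length_concat, hq, hdb])
  have h := (hG.existsUnique_path r v).unique hp' hq'
  simpa using congrArg SimpleGraph.Walk.penultimate h

/-- In a rooted tree, every core vertex has a supported child. -/
theorem exists_adj_mem_supportSet_dist_eq_add_one [Fintype V] {G : SimpleGraph V}
    (hG : G.IsTree) (r : V) {v : V} (hv : v ∈ coreSet G) :
    ∃ w ∈ supportSet G, G.Adj v w ∧ G.dist r w = G.dist r v + 1 := by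
  obtain ⟨a, ha, b, hb, hab, hva, hvb⟩ := exists_ne_adj_mem_supportSet hv
  rcases hG.dist_eq_dist_add_one_of_adj r hva with hda | hda
  · rcases hG.dist_eq_dist_add_one_of_adj r hvb with hdb | hdb
    · exact absurd (eq_of_adj_of_dist_eq_add_one hG hva.symm hvb.symm hda hdb) hab
    · exact ⟨b, hb, hvb, hdb⟩
  · exact ⟨a, ha, hva, hda⟩

/-- In an S-tree there is a matching of size `|Core(S)|` each of whose edges joins
a core vertex with a supported vertex. -/
theorem stmt5 [Fintype V] (S : SimpleGraph V) (hS : IsSTree S) :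
    ∃ M : Finset (Sym2 V), IsMatchingSet S M ∧ M.card = (coreSet S).ncard ∧
      ∀ e ∈ M, ∃ u ∈ coreSet S, ∃ w ∈ supportSet S, e = s(u, w) := by
  obtain ⟨hT, -⟩ := hS
  obtain ⟨r⟩ := hT.connected.nonempty
  choose! f hfs hfa hfd using
    fun v (hv : v ∈ coreSet S) => exists_adj_mem_supportSet_dist_eq_add_one hT r hv
  have hinj : ∀ u ∈ coreSet S, ∀ v ∈ coreSet S, f u = f v → u = v := fun u hu v hv h =>
    eq_of_adj_of_dist_eq_add_one hT (hfa u hu) (h ▸ hfa v hv) (hfd u hu) (h ▸ hfd v hv)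
  have hdisj : ∀ u ∈ coreSet S, u ∉ supportSet S := fun u ⟨w, hw, hwu⟩ hu =>
    isIndep_supportSet hT.isAcyclic w hw u hu hwu
  have hne : ∀ u ∈ coreSet S, ∀ v ∈ coreSet S, u ≠ f v := fun u hu v hv h =>
    hdisj u hu (h ▸ hfs v hv)
  have hmem : ∀ u ∈ coreSet S, ∀ v ∈ coreSet S, ∀ z, z ∈ s(u, f u) → z ∈ s(v, f v) → u = v := by
    intro u hu v hv z hzu hzv
    rcases Sym2.mem_iff.1 hzu with rfl | rfl <;> rcases Sym2.mem_iff.1 hzv with h | h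
    · exact h
    · exact absurd h (hne _ hu v hv)
    · exact absurd h.symm (hne v hv u hu)
    · exact hinj u hu v hv h
  refine ⟨(coreSet S).toFinset.image fun v => s(v, f v), ⟨?_, ?_⟩, ?_, ?_⟩
  · intro e he
    obtain ⟨v, hv, rfl⟩ := Finset.mem_image.1 (Finset.mem_coe.1 he)
    exact hfa v (Set.mem_toFinset.1 hv)
  · intro e he e' he' hee z hz hz'
    obtain ⟨u, hu, rfl⟩ := Finset.mem_image.1 he
    obtain ⟨v, hv, rfl⟩ := Finset.mem_image.1 he'
    obtain rfl := hmem u (Set.mem_toFinset.1 hu) v (Set.mem_toFinset.1 hv) z hz hz'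
    exact hee rfl
  · rw [Finset.card_image_of_injOn, Set.ncard_eq_toFinset_card']
    intro u hu v hv h
    have hu : u ∈ coreSet S := by simpa using hu
    have hv : v ∈ coreSet S := by simpa using hv
    have h : s(u, f u) = s(v, f v) := h
    exact hmem u hu v hv u (Sym2.mem_mk_left _ _) (h ▸ Sym2.mem_mk_left _ _)
  · intro e he
    obtain ⟨v, hv, rfl⟩ := Finset.mem_image.1 he
    have hv := Set.mem_toFinset.1 hv
    exact ⟨v, hv, f v, hfs v hv, rfl⟩

end NullDecomp
end

section
/- Let T be a tree. Then the nullity of T (the dimension of the kernel of its adjacency matrix) equals the sum, over all connected components S of the subgraph of T induced by N[Supp(T)], of the nullity of S: null(T) = Σ_{S ∈ F_S(T)} null(S). Moreover the null space of T is the (internal) direct sum of the zero-extensions of the null spaces of the components S. -/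
open scoped Classical

namespace NullDecomp

variable {V : Type*}

theorem mem_ker_adjMatrix_iff [Fintype V] (G : SimpleGraph V) [DecidableRel G.Adj] (x : V → ℝ) :
    x ∈ LinearMap.ker (Matrix.mulVecLin (G.adjMatrix ℝ)) ↔
      ∀ v, ∑ w, (if G.Adj v w then x w else 0) = 0 := by
  simp only [LinearMap.mem_ker, Matrix.mulVecLin_apply, funext_iff, Pi.zero_apply, Matrix.mulVec,
    dotProduct, SimpleGraph.adjMatrix_apply, ite_mul, one_mul, zero_mul]

/-- Across a bridge `uv`, the alternating form `x u * y v - x v * y u` vanishes on null vectors. -/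
theorem mul_eq_mul_of_isBridge [Fintype V] {G : SimpleGraph V} {u v : V} (huv : G.Adj u v)
    (hb : G.IsBridge s(u, v)) {x y : V → ℝ}
    (hx : ∀ a, ∑ b, (if G.Adj a b then x b else 0) = 0)
    (hy : ∀ a, ∑ b, (if G.Adj a b then y b else 0) = 0) :
    x u * y v = x v * y u := by
  set H := G.deleteEdges {s(u, v)}
  have hv : ¬ H.Reachable u v := hb
  let F : V → V → ℝ := fun a b => if G.Adj a b then x a * y b - x b * y a else 0
  have hF : ∀ a, ∑ b, F a b = 0 := fun a => by
    calc ∑ b, F a b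
        = x a * ∑ b, (if G.Adj a b then y b else 0) -
            y a * ∑ b, (if G.Adj a b then x b else 0) := by
          rw [Finset.mul_sum, Finset.mul_sum, ← Finset.sum_sub_distrib]
          refine Finset.sum_congr rfl fun b _ => ?_
          simp only [F]
          split_ifs <;> ring
      _ = 0 := by rw [hx, hy]; ring
  let U : V → Prop := fun a => H.Reachable u a
  have hcross : ∀ a b, U a → ¬ U b → G.Adj a b → a = u ∧ b = v := by
    intro a b ha hb' hab
    by_contra hne
    have hH : H.Adj a b := by
      rw [SimpleGraph.deleteEdges_adj]
      refine ⟨hab, fun he => ?_⟩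
      rcases Sym2.eq_iff.mp (Set.mem_singleton_iff.mp he) with h | h
      · exact hne h
      · exact hv (h.1 ▸ ha)
    exact hb' (ha.trans hH.reachable)
  have htotal : ∑ a with U a, ∑ b, F a b = 0 := Finset.sum_eq_zero fun a _ => hF a
  have hinner : ∑ a with U a, ∑ b with U b, F a b = 0 := by
    have hneg : ∑ a with U a, ∑ b with U b, F a b = -∑ a with U a, ∑ b with U b, F a b := by
      conv_lhs => rw [Finset.sum_comm]
      simp only [← Finset.sum_neg_distrib]
      refine Finset.sum_congr rfl fun a _ => Finset.sum_congr rfl fun b _ => ?_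
      simp only [F, G.adj_comm b a]
      split_ifs <;> ring
    linarith
  have houter : ∑ a with U a, ∑ b with ¬ U b, F a b = F u v := by
    rw [Finset.sum_eq_single_of_mem u (by simp [U])]
    · rw [Finset.sum_eq_single_of_mem v (by simpa [U] using hv)]
      intro b hb' hne
      exact if_neg fun hab => hne (hcross u b (SimpleGraph.Reachable.refl u)
        (Finset.mem_filter.mp hb').2 hab).2
    · intro a ha hne
      refine Finset.sum_eq_zero fun b hb' => if_neg fun hab => hne ?_
      exact (hcross a b (Finset.mem_filter.mp ha).2 (Finset.mem_filter.mp hb').2 hab).1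
  have hsplit : ∑ a with U a, ∑ b, F a b =
      ∑ a with U a, ∑ b with U b, F a b + ∑ a with U a, ∑ b with ¬ U b, F a b := by
    rw [← Finset.sum_add_distrib]
    exact Finset.sum_congr rfl fun a _ => (Finset.sum_filter_add_sum_filter_not _ _ _).symm
  have huvF : F u v = 0 := by linarith
  simp only [F, if_pos huv] at huvF
  linarith

/-- In a forest, the two ends of an edge do not both lie in the support of the null space. -/
theorem mul_eq_zero_of_isAcyclic [Fintype V] {G : SimpleGraph V} (hG : G.IsAcyclic) {u v : V}
    (huv : G.Adj u v) {x y : V → ℝ}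
    (hx : x ∈ LinearMap.ker (Matrix.mulVecLin (G.adjMatrix ℝ)))
    (hy : y ∈ LinearMap.ker (Matrix.mulVecLin (G.adjMatrix ℝ))) :
    x u * y v = 0 := by
  rw [mem_ker_adjMatrix_iff] at hx hy
  have hb : G.IsBridge s(u, v) := SimpleGraph.isAcyclic_iff_forall_isBridge.mp hG huv
  let σ : V → ℝ := fun a => if hG.coloringTwo a = 0 then 1 else -1
  have hσ : ∀ {a b}, G.Adj a b → σ b = -σ a := by
    intro a b hab
    have hne := hG.coloringTwo.valid hab
    simp only [σ]
    split_ifs with h₁ h₂ h₂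
    · exact absurd (h₂.trans h₁.symm) hne
    · norm_num
    · norm_num
    · exact absurd (by omega) hne
  have hσy : ∀ a, ∑ b, (if G.Adj a b then σ b * y b else 0) = 0 := fun a => by
    calc ∑ b, (if G.Adj a b then σ b * y b else 0)
        = -σ a * ∑ b, (if G.Adj a b then y b else 0) := by
          rw [Finset.mul_sum]
          refine Finset.sum_congr rfl fun b _ => ?_
          split_ifs with h
          · rw [hσ h]
          · ring
      _ = 0 := by rw [hy, mul_zero]
  have h₁ := mul_eq_mul_of_isBridge huv hb hx hy
  have h₂ := mul_eq_mul_of_isBridge huv hb hx hσy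
  rw [hσ huv] at h₂
  have hne : σ u ≠ 0 := by
    simp only [σ]
    split_ifs <;> norm_num
  refine (mul_eq_zero.mp (?_ : σ u * (x u * y v) = 0)).resolve_left hne
  linear_combination (σ u / 2) * h₁ - h₂ / 2

theorem sum_induce_eq [Fintype V] (G : SimpleGraph V) (C : Set V) [Fintype C] {x : V → ℝ}
    (v : C) (hx : ∀ w, G.Adj v w → w ∉ C → x w = 0) :
    ∑ w : C, (if (G.induce C).Adj v w then x w else 0) =
      ∑ w, (if G.Adj v w then x w else 0) := by
  refine Fintype.sum_of_injective (Subtype.val : C → V) Subtype.val_injective _ _ ?_ fun w => ?_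
  · intro w hw
    split_ifs with h
    · exact hx w h fun hC => hw ⟨⟨w, hC⟩, rfl⟩
    · rfl
  · simp only [SimpleGraph.comap_adj, Function.Embedding.subtype_apply]

theorem comp_val_mem_ker_iff [Fintype V] (G : SimpleGraph V) (C : Set V) [Fintype C] {x : V → ℝ}
    (hx : ∀ v ∈ C, ∀ w, G.Adj v w → w ∉ C → x w = 0) :
    x ∘ Subtype.val ∈ LinearMap.ker (Matrix.mulVecLin ((G.induce C).adjMatrix ℝ)) ↔
      ∀ v ∈ C, ∑ w, (if G.Adj v w then x w else 0) = 0 := by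
  rw [mem_ker_adjMatrix_iff, Subtype.forall]
  refine forall₂_congr fun v hv => ?_
  rw [← sum_induce_eq G C ⟨v, hv⟩ (hx v hv)]
  rfl

theorem mem_extNull_iff_comp_val [Fintype V] (G : SimpleGraph V) (C : Set V) [Fintype C]
    (x : V → ℝ) :
    x ∈ extNull G C ↔
      x ∘ Subtype.val ∈ LinearMap.ker (Matrix.mulVecLin ((G.induce C).adjMatrix ℝ)) ∧
        ∀ v ∉ C, x v = 0 := by
  rw [extNull, Submodule.mem_inf]
  refine and_congr ?_ ?_
  · rw [LinearMap.mem_ker, LinearMap.comp_apply, ← LinearMap.mem_ker]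
    convert Iff.rfl
    rfl
  · simp [LinearMap.mem_ker, funext_iff, LinearMap.funLeft_apply]

theorem mem_extNull_iff [Fintype V] (G : SimpleGraph V) (C : Set V) (x : V → ℝ) :
    x ∈ extNull G C ↔
      (∀ v ∈ C, ∑ w, (if G.Adj v w then x w else 0) = 0) ∧ ∀ v ∉ C, x v = 0 := by
  rw [mem_extNull_iff_comp_val]
  exact and_congr_left fun h => comp_val_mem_ker_iff G C fun _ _ w _ hw => h w hw

theorem finrank_extNull [Fintype V] (G : SimpleGraph V) (C : Set V) [Fintype C] :
    Module.finrank ℝ (extNull G C) = nullity (G.induce C) := by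
  let f := Function.ExtendByZero.linearMap ℝ (Subtype.val : C → V)
  have hf : ∀ (y : C → ℝ), f y ∘ Subtype.val = y := fun y =>
    funext fun v => Subtype.val_injective.extend_apply y (0 : V → ℝ) v
  have hf₀ : ∀ (y : C → ℝ), ∀ v ∉ C, f y v = 0 := fun y v hv =>
    Function.extend_apply' y (0 : V → ℝ) v fun ⟨a, ha⟩ => hv (ha ▸ a.2)
  have hinj : Function.Injective f := fun y z h => by rw [← hf y, h, hf]
  have hmap : (LinearMap.ker (Matrix.mulVecLin ((G.induce C).adjMatrix ℝ))).map f =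
      extNull G C := by
    ext x
    rw [Submodule.mem_map, mem_extNull_iff_comp_val]
    constructor
    · rintro ⟨y, hy, rfl⟩
      exact ⟨(hf y).symm ▸ hy, hf₀ y⟩
    · rintro ⟨hx, hx₀⟩
      refine ⟨x ∘ Subtype.val, hx, funext fun v => ?_⟩
      by_cases hv : v ∈ C
      · exact congrFun (hf (x ∘ Subtype.val)) ⟨v, hv⟩
      · rw [hf₀ _ v hv, hx₀ v hv]
  rw [← hmap, nullity]
  exact (Submodule.equivMapOfInjective f hinj _).finrank_eq.symm

theorem finrank_iSup_of_iSupIndep {K M ι : Type*} [Field K] [AddCommGroup M] [Module K M]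
    [FiniteDimensional K M] [Fintype ι] {p : ι → Submodule K M} (hp : iSupIndep p) :
    Module.finrank K (⨆ i, p i : Submodule K M) = ∑ i, Module.finrank K (p i) := by
  rw [← Module.finrank_directSum, Submodule.iSup_eq_range_dfinsupp_lsum]
  exact (LinearEquiv.ofInjective _ hp.dfinsupp_lsum_injective).finrank_eq.symm

theorem mem_supp_of_adj {G : SimpleGraph V} {A : Set V} {c : (G.induce A).ConnectedComponent}
    {v w : V} (hv : v ∈ Subtype.val '' c.supp) (hw : w ∈ A) (h : G.Adj v w) :
    w ∈ Subtype.val '' c.supp := by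
  obtain ⟨v, hv, rfl⟩ := hv
  exact ⟨⟨w, hw⟩, c.mem_supp_of_adj_mem_supp hv h, rfl⟩

theorem mem_supp_iff {G : SimpleGraph V} {A : Set V} {c : (G.induce A).ConnectedComponent}
    {v : V} (hv : v ∈ A) :
    v ∈ Subtype.val '' c.supp ↔ (G.induce A).connectedComponentMk ⟨v, hv⟩ = c := by
  constructor
  · rintro ⟨w, hw, rfl⟩
    exact hw
  · exact fun h => ⟨⟨v, hv⟩, h, rfl⟩

theorem mem_supportSet [Fintype V] {G : SimpleGraph V} {x : V → ℝ}
    (hx : x ∈ LinearMap.ker (Matrix.mulVecLin (G.adjMatrix ℝ))) {v : V} (hv : x v ≠ 0) :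
    v ∈ supportSet G :=
  ⟨x, hx, hv⟩

theorem indicator_mem_extNull [Fintype V] {G : SimpleGraph V}
    (c : (G.induce (closedNbhd G (supportSet G))).ConnectedComponent) {x : V → ℝ}
    (hx : x ∈ LinearMap.ker (Matrix.mulVecLin (G.adjMatrix ℝ))) :
    (Subtype.val '' c.supp).indicator x ∈ extNull G (Subtype.val '' c.supp) := by
  refine (mem_extNull_iff _ _ _).mpr ⟨fun v hv => ?_, fun v hv => Set.indicator_of_notMem hv x⟩
  refine (Finset.sum_congr rfl fun w _ => ?_).trans ((mem_ker_adjMatrix_iff G x).mp hx v)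
  split_ifs with h
  · by_cases hw : x w = 0
    · simp [Set.indicator_apply, hw]
    · exact Set.indicator_of_mem (mem_supp_of_adj hv (Or.inl (mem_supportSet hx hw)) h) x
  · rfl

theorem extNull_le_ker [Fintype V] {G : SimpleGraph V} (hG : G.IsAcyclic)
    (c : (G.induce (closedNbhd G (supportSet G))).ConnectedComponent) :
    extNull G (Subtype.val '' c.supp) ≤
      LinearMap.ker (Matrix.mulVecLin (G.adjMatrix ℝ)) := by
  intro x hx
  obtain ⟨hx₁, hx₀⟩ := (mem_extNull_iff _ _ _).mp hx
  have hsupp : ∀ w, x w ≠ 0 → w ∈ supportSet G := by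
    intro w hw
    have hwc : w ∈ Subtype.val '' c.supp := by
      by_contra h
      exact hw (hx₀ w h)
    obtain ⟨⟨w, hwN⟩, -, rfl⟩ := id hwc
    rcases hwN with hwS | ⟨s, hs, hsw⟩
    · exact hwS
    · obtain ⟨z, hz, hzs⟩ := id hs
      have hsc := mem_supp_of_adj hwc (Or.inl hs) hsw.symm
      have hz' := ((mem_extNull_iff_comp_val _ _ _).mp (indicator_mem_extNull c hz)).1
      have hx' := ((mem_extNull_iff_comp_val _ _ _).mp hx).1
      have h := mul_eq_zero_of_isAcyclic (hG.induce (Subtype.val '' c.supp))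
        (u := ⟨w, hwc⟩) (v := ⟨s, hsc⟩) hsw.symm hx' hz'
      simp only [Function.comp_apply, Set.indicator_of_mem hsc] at h
      exact absurd h (mul_ne_zero hw hzs)
  refine (mem_ker_adjMatrix_iff _ _).mpr fun v => ?_
  by_cases hv : v ∈ Subtype.val '' c.supp
  · exact hx₁ v hv
  · refine Finset.sum_eq_zero fun w _ => ite_eq_right_iff.mpr fun hvw => ?_
    by_contra hw
    refine hv (mem_supp_of_adj ?_ (Or.inr ⟨w, hsupp w hw, hvw.symm⟩) hvw.symm)
    by_contra h
    exact hw (hx₀ w h)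

theorem iSup_extNull [Fintype V] {G : SimpleGraph V} (hG : G.IsAcyclic) :
    (⨆ c : (G.induce (closedNbhd G (supportSet G))).ConnectedComponent,
        extNull G (Subtype.val '' c.supp)) =
      LinearMap.ker (Matrix.mulVecLin (G.adjMatrix ℝ)) := by
  refine le_antisymm (iSup_le fun c => extNull_le_ker hG c) fun x hx => ?_
  have hsum : x = ∑ c : (G.induce (closedNbhd G (supportSet G))).ConnectedComponent,
      (Subtype.val '' c.supp).indicator x := by
    funext v
    rw [Finset.sum_apply]
    by_cases hv : x v = 0
    · exact hv.trans (Finset.sum_eq_zero fun c _ => by simp [Set.indicator_apply, hv]).symm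
    · have hN : v ∈ closedNbhd G (supportSet G) := Or.inl (mem_supportSet hx hv)
      simp only [Set.indicator_apply, mem_supp_iff hN, Finset.sum_ite_eq, Finset.mem_univ, if_true]
  rw [hsum]
  exact Submodule.sum_mem _ fun c _ =>
    Submodule.mem_iSup_of_mem c (indicator_mem_extNull c hx)

theorem iSupIndep_extNull [Fintype V] (G : SimpleGraph V) (A : Set V) :
    iSupIndep fun c : (G.induce A).ConnectedComponent => extNull G (Subtype.val '' c.supp) := by
  intro c
  rw [Submodule.disjoint_def]
  intro x hx hx'
  have hle : (⨆ d : (G.induce A).ConnectedComponent, ⨆ _ : d ≠ c,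
      extNull G (Subtype.val '' d.supp)) ≤
      LinearMap.ker (LinearMap.funLeft ℝ ℝ (Subtype.val : ↥(Subtype.val '' c.supp) → V)) := by
    refine iSup₂_le fun d hd y hy => funext fun ⟨v, hv⟩ => ?_
    refine ((mem_extNull_iff _ _ _).mp hy).2 v fun hvd => hd ?_
    obtain ⟨⟨v, hA⟩, -, rfl⟩ := id hv
    rw [← (mem_supp_iff hA).mp hv, ← (mem_supp_iff hA).mp hvd]
  funext v
  by_cases hv : v ∈ Subtype.val '' c.supp
  · exact congrFun (hle hx') ⟨v, hv⟩
  · exact ((mem_extNull_iff _ _ _).mp hx).2 v hv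

/-- The nullity of a tree is the sum of the nullities of the components of the
subgraph induced by `N[Supp(T)]`, and the null space of `T` is the internal direct
sum of the zero-extensions of the null spaces of these components. -/
theorem stmt15 [Fintype V] (T : SimpleGraph V) (hT : T.IsTree) :
    nullity T =
      (∑ c : (T.induce (closedNbhd T (supportSet T))).ConnectedComponent,
        nullity (T.induce (Subtype.val '' c.supp))) ∧
    (∀ c : (T.induce (closedNbhd T (supportSet T))).ConnectedComponent,
      Disjoint (extNull T (Subtype.val '' c.supp))
        (⨆ d : (T.induce (closedNbhd T (supportSet T))).ConnectedComponent,
          ⨆ _ : d ≠ c, extNull T (Subtype.val '' d.supp))) ∧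
    (⨆ c : (T.induce (closedNbhd T (supportSet T))).ConnectedComponent,
        extNull T (Subtype.val '' c.supp)) =
      LinearMap.ker (Matrix.mulVecLin (T.adjMatrix ℝ)) := by
  refine ⟨?_, iSupIndep_extNull T _, iSup_extNull hT.isAcyclic⟩
  rw [nullity, ← iSup_extNull hT.isAcyclic, finrank_iSup_of_iSupIndep (iSupIndep_extNull T _)]
  exact Finset.sum_congr rfl fun c _ => finrank_extNull T _

end NullDecomp
end
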